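/- Let d, T ≥ 1 with d^T / (d(d+1)⋯(d+T−1)) > 1/2. Let {A_k}_k be any basis of the linear span of the permutation operators {P_π : π ∈ S_T} inside the d^T × d^T complex matrices, orthonormal with respect to the Hilbert–Schmidt inner product tr(X†Y). Then Σ_k A_k ⊗ A_k^* − (1/(d(d+1)⋯(d+T−1))) Σ_{π ∈ S_T} P_π ⊗ P_π^* is positive semidefinite, where ⊗ is the Kronecker product and X^* is the entrywise complex conjugate of X. -/

import Mathlib

open Matrix
open scoped Kronecker ComplexOrder

/-- A Schur test for the frame operator of a finite family of vectors. -/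
theorem sum_norm_inner_sq_le {E ι : Type*} [NormedAddCommGroup E] [InnerProductSpace ℂ E]
    [Fintype ι] (p : ι → E) {D : ℝ} (hD : 0 ≤ D) (hp : ∀ i, ∑ j, ‖inner ℂ (p i) (p j)‖ ≤ D)
    (x : E) : ∑ i, ‖inner ℂ (p i) x‖ ^ 2 ≤ D * ‖x‖ ^ 2 := by
  set a : ι → ℂ := fun i => inner ℂ (p i) x with ha
  set S : ℝ := ∑ i, ‖a i‖ ^ 2 with hS
  set r : E := ∑ i, a i • p i with hr
  have hS0 : 0 ≤ S := Finset.sum_nonneg fun i _ => sq_nonneg _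
  have hrx : inner ℂ r x = (S : ℂ) := by
    rw [hr, sum_inner, hS, Complex.ofReal_sum]
    refine Finset.sum_congr rfl fun i _ => ?_
    rw [inner_smul_left, Complex.ofReal_pow, ← Complex.conj_mul']
  have hrr : ‖r‖ ^ 2 ≤ D * S := by
    have h1 : ‖r‖ ^ 2 ≤ ∑ i, ∑ j, ‖a i‖ * ‖a j‖ * ‖inner ℂ (p i) (p j)‖ := by
      have h2 : ‖inner ℂ r r‖ = ‖r‖ ^ 2 := by
        rw [inner_self_eq_norm_sq_to_K]; simp
      rw [← h2, hr, sum_inner]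
      refine (norm_sum_le _ _).trans (Finset.sum_le_sum fun i _ => ?_)
      rw [inner_sum]
      refine (norm_sum_le _ _).trans (Finset.sum_le_sum fun j _ => ?_)
      rw [inner_smul_left, inner_smul_right]
      simp [mul_assoc]
    have hsymm : ∑ i, ∑ j, ‖a j‖ ^ 2 * ‖inner ℂ (p i) (p j)‖ =
        ∑ i, ∑ j, ‖a i‖ ^ 2 * ‖inner ℂ (p i) (p j)‖ := by
      rw [Finset.sum_comm]
      simp_rw [norm_inner_symm]
    have hbound : ∑ i, ∑ j, ‖a i‖ ^ 2 * ‖inner ℂ (p i) (p j)‖ ≤ D * S := by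
      rw [hS, Finset.mul_sum]
      refine Finset.sum_le_sum fun i _ => ?_
      rw [← Finset.mul_sum, mul_comm]
      exact mul_le_mul_of_nonneg_right (hp i) (sq_nonneg _)
    have h3 : 2 * ∑ i, ∑ j, ‖a i‖ * ‖a j‖ * ‖inner ℂ (p i) (p j)‖ ≤
        ∑ i, ∑ j, ‖a i‖ ^ 2 * ‖inner ℂ (p i) (p j)‖ +
          ∑ i, ∑ j, ‖a j‖ ^ 2 * ‖inner ℂ (p i) (p j)‖ := by
      simp_rw [Finset.mul_sum, ← Finset.sum_add_distrib]
      refine Finset.sum_le_sum fun i _ => Finset.sum_le_sum fun j _ => ?_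
      nlinarith [mul_nonneg (sq_nonneg (‖a i‖ - ‖a j‖)) (norm_nonneg (inner ℂ (p i) (p j)))]
    linarith
  have hle : S ≤ ‖r‖ * ‖x‖ := by
    have := norm_inner_le_norm (𝕜 := ℂ) r x
    rwa [hrx, Complex.norm_of_nonneg hS0] at this
  have hsq : S ^ 2 ≤ D * S * ‖x‖ ^ 2 := by
    calc S ^ 2 ≤ (‖r‖ * ‖x‖) ^ 2 := pow_le_pow_left₀ hS0 hle 2
      _ = ‖r‖ ^ 2 * ‖x‖ ^ 2 := mul_pow _ _ _
      _ ≤ D * S * ‖x‖ ^ 2 := mul_le_mul_of_nonneg_right hrr (sq_nonneg _)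
  rcases hS0.eq_or_lt with h0 | hpos
  · rw [← h0]; positivity
  · exact le_of_mul_le_mul_left (by linarith) hpos

section Orthonormal

variable {n κ : Type*} [Fintype n] [Fintype κ] [DecidableEq κ] {A : κ → Matrix n n ℂ}

theorem Matrix.eq_sum_trace_smul_of_mem_span
    (hA : ∀ k l, trace ((A k)ᴴ * A l) = if k = l then (1 : ℂ) else 0) {M : Matrix n n ℂ}
    (hM : M ∈ Submodule.span ℂ (Set.range A)) : M = ∑ k, trace ((A k)ᴴ * M) • A k := by
  induction hM using Submodule.span_induction with
  | mem x hx =>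
    obtain ⟨l, rfl⟩ := hx
    simp [hA]
  | zero => simp
  | add x y _ _ hx hy =>
    conv_lhs => rw [hx, hy]
    simp [Matrix.mul_add, add_smul, Finset.sum_add_distrib]
  | smul c x _ hx =>
    conv_lhs => rw [hx]
    simp [Finset.smul_sum, smul_smul]

theorem Matrix.trace_conjTranspose_mul_of_mem_span
    (hA : ∀ k l, trace ((A k)ᴴ * A l) = if k = l then (1 : ℂ) else 0) {M N : Matrix n n ℂ}
    (hM : M ∈ Submodule.span ℂ (Set.range A)) :
    trace (Mᴴ * N) = ∑ k, star (trace ((A k)ᴴ * M)) * trace ((A k)ᴴ * N) := by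
  conv_lhs => rw [eq_sum_trace_smul_of_mem_span hA hM]
  simp [conjTranspose_sum, Finset.sum_mul, trace_sum]

/-- `∑ k, A k ⊗ conj (A k)` does not depend on the orthonormal basis `A` of a given span. -/
theorem Matrix.sum_kronecker_map_star_eq
    (hA : ∀ k l, trace ((A k)ᴴ * A l) = if k = l then (1 : ℂ) else 0) {B : κ → Matrix n n ℂ}
    (hB : ∀ k l, trace ((B k)ᴴ * B l) = if k = l then (1 : ℂ) else 0)
    (hBA : ∀ k, B k ∈ Submodule.span ℂ (Set.range A)) :
    ∑ k, B k ⊗ₖ (B k).map (starRingEnd ℂ) = ∑ k, A k ⊗ₖ (A k).map (starRingEnd ℂ) := by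
  set u : Matrix κ κ ℂ := of fun k l => trace ((A k)ᴴ * B l) with hu
  have huu : uᴴ * u = 1 := by
    ext k l
    rw [one_apply, ← hB, trace_conjTranspose_mul_of_mem_span hA (hBA k)]
    simp [mul_apply, hu]
  have huu' : u * uᴴ = 1 := mul_eq_one_comm.mp huu
  have hBu : ∀ l i j, B l i j = ∑ k, u k l * A k i j := fun l i j => by
    conv_lhs => rw [eq_sum_trace_smul_of_mem_span hA (hBA l)]
    simp [Matrix.sum_apply, hu]
  have huu'' : ∀ k k', ∑ l, u k l * star (u k' l) = if k = k' then 1 else 0 := fun k k' => by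
    rw [← one_apply, ← huu', mul_apply]; rfl
  ext ⟨i, i'⟩ ⟨j, j'⟩
  simp only [Matrix.sum_apply, kroneckerMap_apply, map_apply]
  calc ∑ l, B l i j * (starRingEnd ℂ) (B l i' j')
      = ∑ l, ∑ k, ∑ k', u k l * star (u k' l) * (A k i j * star (A k' i' j')) := by
        refine Finset.sum_congr rfl fun l _ => ?_
        rw [hBu, hBu, map_sum, Finset.sum_mul_sum]
        refine Finset.sum_congr rfl fun k _ => Finset.sum_congr rfl fun k' _ => ?_
        simp only [map_mul, starRingEnd_apply]
        ring
    _ = ∑ k, ∑ k', (∑ l, u k l * star (u k' l)) * (A k i j * star (A k' i' j')) := by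
        rw [Finset.sum_comm]
        refine Finset.sum_congr rfl fun k _ => ?_
        rw [Finset.sum_comm]
        simp_rw [Finset.sum_mul]
    _ = _ := by simp_rw [huu'']; simp

theorem Matrix.sum_norm_sq_apply_le {ι : Type*} [Fintype ι]
    (hA : ∀ k l, trace ((A k)ᴴ * A l) = if k = l then (1 : ℂ) else 0) (p : ι → Matrix n n ℂ)
    (hpA : ∀ i, p i ∈ Submodule.span ℂ (Set.range A)) {D : ℝ} (hD : 0 ≤ D)
    (hp : ∀ i, ∑ j, ‖trace ((p i)ᴴ * p j)‖ ≤ D) (L : Matrix n n ℂ →ₗ[ℂ] ℂ) :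
    ∑ i, ‖L (p i)‖ ^ 2 ≤ D * ∑ k, ‖L (A k)‖ ^ 2 := by
  let q : ι → EuclideanSpace ℂ κ := fun i => WithLp.toLp 2 fun k => star (trace ((A k)ᴴ * p i))
  let x : EuclideanSpace ℂ κ := WithLp.toLp 2 fun k => L (A k)
  have hq : ∀ i j, ‖inner ℂ (q i) (q j)‖ = ‖trace ((p i)ᴴ * p j)‖ := fun i j => by
    rw [← norm_star (trace _), trace_conjTranspose_mul_of_mem_span hA (hpA i)]
    simp [q, PiLp.inner_apply, mul_comm]
  have hx : ∀ i, inner ℂ (q i) x = L (p i) := fun i => by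
    conv_rhs => rw [eq_sum_trace_smul_of_mem_span hA (hpA i)]
    simp [q, x, PiLp.inner_apply, mul_comm]
  have := sum_norm_inner_sq_le q hD (fun i => by simpa only [hq] using hp i) x
  simpa only [hx, EuclideanSpace.norm_sq_eq, x] using this

theorem Matrix.star_vec_dotProduct_kronecker_map_star_mulVec {M Y : Matrix n n ℂ}
    (h : Commute Y Mᵀ) :
    star (vec Y) ⬝ᵥ ((M ⊗ₖ M.map (starRingEnd ℂ)) *ᵥ vec Y) =
      ((∑ i, ∑ j, ‖(Mᵀ * Y) i j‖ ^ 2 : ℝ) : ℂ) := by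
  have hM : M.map (starRingEnd ℂ) = (Mᵀ)ᴴ := by ext; simp
  rw [kronecker_mulVec_vec, star_vec_dotProduct_vec, hM, Matrix.mul_assoc, h.eq,
    ← Matrix.mul_assoc, ← conjTranspose_mul, trace_mul_comm, trace]
  push_cast
  refine Finset.sum_congr rfl fun i _ => ?_
  rw [diag_apply, mul_apply]
  refine Finset.sum_congr rfl fun j _ => ?_
  rw [conjTranspose_apply, ← starRingEnd_apply, Complex.mul_conj']

end Orthonormal

section Representation

variable {G n κ : Type*} [Group G] [Fintype G] [Fintype n] [DecidableEq n] [Fintype κ]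
  [DecidableEq κ]

/-- For a unitary representation `ρ` of a finite group with `∑ g, |tr ρ(g)| ≤ D` and any
Hilbert–Schmidt-orthonormal basis `A` of the span of `ρ`, the matrix
`∑ k, A k ⊗ conj (A k) - D⁻¹ ∑ g, ρ g ⊗ conj (ρ g)` is positive semidefinite. -/
theorem Matrix.posSemidef_sum_kronecker_sub_smul_sum_kronecker (ρ : G →* Matrix n n ℂ)
    (hρ : ∀ g, (ρ g)ᴴ = ρ g⁻¹) {D : ℝ} (hD : 0 < D) (htr : ∑ g, ‖trace (ρ g)‖ ≤ D)
    {A : κ → Matrix n n ℂ}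
    (hspan : Submodule.span ℂ (Set.range A) = Submodule.span ℂ (Set.range ρ))
    (hA : ∀ k l, trace ((A k)ᴴ * A l) = if k = l then (1 : ℂ) else 0) :
    ((∑ k, A k ⊗ₖ (A k).map (starRingEnd ℂ)) -
      (D : ℂ)⁻¹ • ∑ g, ρ g ⊗ₖ (ρ g).map (starRingEnd ℂ)).PosSemidef := by
  have hAρ : ∀ k, A k ∈ Submodule.span ℂ (Set.range ρ) := fun k =>
    hspan ▸ Submodule.subset_span ⟨k, rfl⟩
  have hρA : ∀ g, ρ g ∈ Submodule.span ℂ (Set.range A) := fun g =>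
    hspan ▸ Submodule.subset_span ⟨g, rfl⟩
  have hinv : ∀ g, (ρ g)ᴴ * ρ g = 1 := fun g => by rw [hρ, ← map_mul]; simp
  set U : G → Matrix (n × n) (n × n) ℂ := fun g => ρ g ⊗ₖ (ρ g).map (starRingEnd ℂ) with hU
  set R : Matrix (n × n) (n × n) ℂ := ∑ g, U g with hR
  set S : Matrix (n × n) (n × n) ℂ := ∑ k, A k ⊗ₖ (A k).map (starRingEnd ℂ) with hS
  have hUmul : ∀ g h, U g * U h = U (g * h) := fun g h => by
    simp [hU, ← mul_kronecker_mul, ← Matrix.map_mul]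
  have hUstar : ∀ g, (U g)ᴴ = U g⁻¹ := fun g => by
    simp only [hU, conjTranspose_kronecker, ← hρ]
    rfl
  have hUR : ∀ g, U g * R = R := fun g => by
    rw [hR, Finset.mul_sum]
    simp_rw [hUmul]
    exact Equiv.sum_comp (Equiv.mulLeft g) U
  have hRstar : Rᴴ = R := by
    rw [hR, conjTranspose_sum]
    simp_rw [hUstar]
    exact Equiv.sum_comp (Equiv.inv G) U
  have hUS : ∀ g, U g * S = S := fun g => by
    rw [hS, Finset.mul_sum]
    simp_rw [hU, ← mul_kronecker_mul, ← Matrix.map_mul]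
    refine sum_kronecker_map_star_eq hA (fun k l => ?_) fun k => ?_
    · rw [conjTranspose_mul, Matrix.mul_assoc, ← Matrix.mul_assoc _ (ρ g), hinv,
        Matrix.one_mul, hA]
    · rw [hspan]
      have hk := hAρ k
      generalize A k = M at hk
      induction hk using Submodule.span_induction with
      | mem x hx =>
        obtain ⟨h, rfl⟩ := hx
        exact Submodule.subset_span ⟨g * h, map_mul ρ g h⟩
      | zero => simp
      | add x y _ _ hx hy => rw [Matrix.mul_add]; exact add_mem hx hy
      | smul c x _ hx => rw [Matrix.mul_smul]; exact Submodule.smul_mem _ _ hx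
  have hSstar : Sᴴ = S := by
    have hstar : Sᴴ = ∑ k, (A k)ᴴ ⊗ₖ ((A k)ᴴ).map (starRingEnd ℂ) := by
      rw [hS, conjTranspose_sum]
      simp_rw [conjTranspose_kronecker]
      rfl
    rw [hstar]
    refine sum_kronecker_map_star_eq hA (fun k l => ?_) fun k => ?_
    · rw [conjTranspose_conjTranspose, trace_mul_comm, hA]
      simp [eq_comm]
    · rw [hspan]
      have hk := hAρ k
      generalize A k = M at hk
      induction hk using Submodule.span_induction with
      | mem x hx =>
        obtain ⟨h, rfl⟩ := hx
        exact Submodule.subset_span ⟨h⁻¹, (hρ h).symm⟩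
      | zero => simp
      | add x y _ _ hx hy => rw [conjTranspose_add]; exact add_mem hx hy
      | smul c x _ hx => rw [conjTranspose_smul]; exact Submodule.smul_mem _ _ hx
  set N : ℂ := (Fintype.card G : ℂ) with hN
  have hN0 : N ≠ 0 := by simp [hN]
  have hRS : R * S = N • S := by
    rw [hR, Finset.sum_mul]; simp [hUS, hN, Nat.cast_smul_eq_nsmul]
  have hSR : S * R = N • S := by
    have := congrArg conjTranspose hRS
    simpa [hRstar, hSstar, hN] using this
  have hRR : R * R = N • R := by
    conv_lhs => enter [1]; rw [hR]
    rw [Finset.sum_mul]; simp [hUR, hN, Nat.cast_smul_eq_nsmul]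
  set Q := S - (D : ℂ)⁻¹ • R with hQ
  have hQR : R * Q * R = (N * N) • Q := by
    simp only [hQ, Matrix.mul_sub, Matrix.sub_mul, Matrix.mul_smul, Matrix.smul_mul, hRS, hRR,
      hSR, smul_sub, smul_smul]
    congr 2
    ring
  have hinvariant : ∀ Y : Matrix n n ℂ, (∀ g, U g *ᵥ vec Y = vec Y) →
      0 ≤ star (vec Y) ⬝ᵥ (Q *ᵥ vec Y) := fun Y hY => by
    have hcomm : ∀ M ∈ Submodule.span ℂ (Set.range ρ), Commute Y Mᵀ := fun M hM => by
      induction hM using Submodule.span_induction with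
      | mem x hx =>
        obtain ⟨g, rfl⟩ := hx
        have h1 := hY g
        rw [hU, kronecker_mulVec_vec, vec_inj] at h1
        have h2 : (ρ g)ᵀ * (ρ g).map (starRingEnd ℂ) = 1 := by
          have := congrArg transpose (hinv g)
          rwa [transpose_mul, transpose_one] at this
        have h3 := congrArg (fun Z => (ρ g)ᵀ * Z) h1
        simp only [← Matrix.mul_assoc, h2, Matrix.one_mul] at h3
        exact h3
      | zero => simp
      | add x y _ _ hx hy => rw [transpose_add]; exact hx.add_right hy
      | smul c x _ hx => rw [transpose_smul]; exact hx.smul_right c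
    have hle : ∑ g, ∑ i, ∑ j, ‖((ρ g)ᵀ * Y) i j‖ ^ 2 ≤
        D * ∑ k, ∑ i, ∑ j, ‖((A k)ᵀ * Y) i j‖ ^ 2 := by
      rw [Finset.sum_comm, Finset.sum_comm (s := (Finset.univ : Finset κ)), Finset.mul_sum]
      refine Finset.sum_le_sum fun i _ => ?_
      rw [Finset.sum_comm, Finset.sum_comm (s := (Finset.univ : Finset κ)), Finset.mul_sum]
      refine Finset.sum_le_sum fun j _ => ?_
      refine sum_norm_sq_apply_le hA ρ hρA hD.le (fun g => ?_)
        { toFun := fun M => (Mᵀ * Y) i j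
          map_add' := fun M M' => by simp [Matrix.add_mul]
          map_smul' := fun c M => by simp }
      simp_rw [hρ, ← map_mul]
      exact (Equiv.sum_comp (Equiv.mulLeft g⁻¹) fun h => ‖trace (ρ h)‖).trans_le htr
    have hform : star (vec Y) ⬝ᵥ (Q *ᵥ vec Y) =
        ((∑ k, ∑ i, ∑ j, ‖((A k)ᵀ * Y) i j‖ ^ 2 -
          D⁻¹ * ∑ g, ∑ i, ∑ j, ‖((ρ g)ᵀ * Y) i j‖ ^ 2 : ℝ) : ℂ) := by
      have hSf : star (vec Y) ⬝ᵥ (S *ᵥ vec Y) =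
          ∑ k, ((∑ i, ∑ j, ‖((A k)ᵀ * Y) i j‖ ^ 2 : ℝ) : ℂ) := by
        rw [hS, sum_mulVec, dotProduct_sum]
        exact Finset.sum_congr rfl fun k _ =>
          star_vec_dotProduct_kronecker_map_star_mulVec (hcomm _ (hAρ k))
      have hRf : star (vec Y) ⬝ᵥ (R *ᵥ vec Y) =
          ∑ g, ((∑ i, ∑ j, ‖((ρ g)ᵀ * Y) i j‖ ^ 2 : ℝ) : ℂ) := by
        rw [hR, sum_mulVec, dotProduct_sum]
        exact Finset.sum_congr rfl fun g _ =>
          star_vec_dotProduct_kronecker_map_star_mulVec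
            (hcomm _ (Submodule.subset_span ⟨g, rfl⟩))
      rw [hQ, sub_mulVec, dotProduct_sub, smul_mulVec, dotProduct_smul, hSf, hRf]
      push_cast
      rfl
    rw [hform, Complex.zero_le_real, sub_nonneg, inv_mul_le_iff₀ hD]
    exact hle
  have hQstar : Q.IsHermitian := by
    simp [hQ, IsHermitian, hSstar, hRstar, conjTranspose_smul]
  have hQeq : Q = (N * N)⁻¹ • (R * Q * R) := by
    rw [hQR, smul_smul, inv_mul_cancel₀ (mul_ne_zero hN0 hN0), one_smul]
  have hRQR : (R * Q * R).PosSemidef := by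
    have hR' : R * Q * R = Rᴴ * Q * R := by rw [hRstar]
    refine .of_dotProduct_mulVec_nonneg
      (hR' ▸ isHermitian_conjTranspose_mul_mul R hQstar) fun x => ?_
    obtain ⟨Y, hY⟩ := vec_bijective.surjective (R *ᵥ x)
    have := hinvariant Y fun g => by rw [hY, mulVec_mulVec, hUR]
    rw [hY, star_mulVec, hRstar, ← dotProduct_mulVec] at this
    simpa [mulVec_mulVec, Matrix.mul_assoc] using this
  rw [hQeq]
  refine hRQR.smul ?_
  have : (0 : ℂ) ≤ ((((Fintype.card G : ℝ) * Fintype.card G)⁻¹ : ℝ) : ℂ) := by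
    rw [Complex.zero_le_real]; positivity
  simpa [hN] using this

end Representation

section Permutation

theorem Finset.sum_prod_factorial_card_fiber (ι : Type*) [Fintype ι] [DecidableEq ι] (T : ℕ) :
    ∑ f : Fin T → ι, ∏ a, (Fintype.card {t // f t = a}).factorial =
      ∏ t ∈ Finset.range T, (Fintype.card ι + t) := by
  induction T with
  | zero => simp
  | succ T ih =>
    have hcard : ∀ (a b : ι) (f : Fin T → ι),
        Fintype.card {t // (Fin.cons a f : Fin (T + 1) → ι) t = b} =
          (if a = b then 1 else 0) + Fintype.card {t // f t = b} := fun a b f => by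
      simp_rw [Fintype.card_subtype, Finset.card_filter, Fin.sum_univ_succ]
      simp
    have hprod : ∀ (a : ι) (f : Fin T → ι),
        ∏ b, (Fintype.card {t // (Fin.cons a f : Fin (T + 1) → ι) t = b}).factorial =
          (Fintype.card {t // f t = a} + 1) *
            ∏ b, (Fintype.card {t // f t = b}).factorial := fun a f => by
      have : ∀ b, (Fintype.card {t // (Fin.cons a f : Fin (T + 1) → ι) t = b}).factorial =
          (if a = b then Fintype.card {t // f t = b} + 1 else 1) *
            (Fintype.card {t // f t = b}).factorial := fun b => by
        rw [hcard]
        split_ifs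
        · rw [add_comm, Nat.factorial_succ]
        · simp
      simp_rw [this, Finset.prod_mul_distrib]
      simp
    have hsum : ∀ f : Fin T → ι, ∑ a, (Fintype.card {t // f t = a} + 1) = Fintype.card ι + T := by
      intro f
      have : ∑ a, Fintype.card {t // f t = a} = T := by
        rw [← Fintype.card_sigma, Fintype.card_congr (Equiv.sigmaFiberEquiv f), Fintype.card_fin]
      rw [Finset.sum_add_distrib, this]
      simp [add_comm]
    rw [← (Fin.consEquiv fun _ => ι).sum_comp, Fintype.sum_prod_type_right,
      Finset.prod_range_succ, ← ih, Finset.sum_mul]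
    refine Finset.sum_congr rfl fun f _ => ?_
    simp only [Fin.consEquiv_apply, hprod]
    rw [← Finset.sum_mul, hsum, mul_comm]

/-- The representation of the permutations of `τ` on `(ℂ^ι)^{⊗τ}` by permuting tensor factors. -/
def Matrix.tensorPerm (τ ι : Type*) [Fintype τ] [DecidableEq τ] [Fintype ι] [DecidableEq ι] :
    Equiv.Perm τ →* Matrix (τ → ι) (τ → ι) ℂ where
  toFun π := of fun f g => if f = g ∘ ⇑π⁻¹ then 1 else 0
  map_one' := by ext f g; simp [one_apply]
  map_mul' π σ := by
    ext f g
    simp [mul_apply, Function.comp_assoc]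

variable {τ ι : Type*} [Fintype τ] [DecidableEq τ] [Fintype ι] [DecidableEq ι]

theorem Matrix.tensorPerm_apply (π : Equiv.Perm τ) (f g : τ → ι) :
    tensorPerm τ ι π f g = if f = g ∘ ⇑π⁻¹ then 1 else 0 := rfl

theorem Matrix.conjTranspose_tensorPerm (π : Equiv.Perm τ) :
    (tensorPerm τ ι π)ᴴ = tensorPerm τ ι π⁻¹ := by
  ext f g
  have : g = f ∘ ⇑π⁻¹ ↔ f = g ∘ ⇑π := by
    constructor <;> rintro rfl <;> ext <;> simp
  rw [conjTranspose_apply, tensorPerm_apply, tensorPerm_apply, inv_inv, if_congr this rfl rfl]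
  split_ifs <;> simp

theorem Matrix.trace_tensorPerm (π : Equiv.Perm τ) :
    trace (tensorPerm τ ι π) = (∑ f : τ → ι, if f ∘ ⇑π⁻¹ = f then 1 else 0 : ℕ) := by
  simp [trace, tensorPerm_apply, eq_comm]

theorem Matrix.sum_norm_trace_tensorPerm (T : ℕ) :
    ∑ π, ‖trace (tensorPerm (Fin T) ι π)‖ =
      ∏ t ∈ Finset.range T, ((Fintype.card ι : ℝ) + t) := by
  simp_rw [trace_tensorPerm, Complex.norm_natCast]
  rw [← Nat.cast_sum, Finset.sum_comm]
  have hinv : ∀ f : Fin T → ι, (∑ π : Equiv.Perm (Fin T), if f ∘ ⇑π⁻¹ = f then 1 else 0) =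
      ∑ π : Equiv.Perm (Fin T), if f ∘ ⇑π = f then 1 else 0 := fun f =>
    Equiv.sum_comp (Equiv.inv (Equiv.Perm (Fin T))) fun π => if f ∘ ⇑π = f then 1 else 0
  simp_rw [hinv]
  have := Finset.sum_prod_factorial_card_fiber ι T
  simp_rw [← DomMulAct.stabilizer_card, Fintype.card_subtype, Finset.card_filter] at this
  rw [this]
  push_cast
  rfl

end Permutation

open scoped Kronecker ComplexOrder

/-- If `d^T / (d(d+1)⋯(d+T−1)) > 1/2` and `{A_k}` is any
Hilbert–Schmidt-orthonormal basis of the linear span of the permutation operators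
`{P_π : π ∈ S_T}` on `(ℂ^d)^{⊗T}`, then
`Σ_k A_k ⊗ A_k^* − (1/(d(d+1)⋯(d+T−1))) Σ_π P_π ⊗ P_π^*` is positive semidefinite. -/
theorem sum_kronecker_basis_ge_sum_kronecker_perm
    (d T : ℕ) (hd : 1 ≤ d) (hT : 1 ≤ T)
    (hdT : (d : ℝ) ^ T / ∏ t ∈ Finset.range T, ((d : ℝ) + (t : ℝ)) > 1 / 2)
    (P : Equiv.Perm (Fin T) → Matrix (Fin T → Fin d) (Fin T → Fin d) ℂ)
    (hP : P = fun (π : Equiv.Perm (Fin T)) =>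
      Matrix.of fun f g => if f = g ∘ ⇑π⁻¹ then (1 : ℂ) else 0)
    (m : ℕ) (A : Fin m → Matrix (Fin T → Fin d) (Fin T → Fin d) ℂ)
    (hspan : Submodule.span ℂ (Set.range A) = Submodule.span ℂ (Set.range P))
    (horth : ∀ k l, Matrix.trace ((A k)ᴴ * A l) = if k = l then (1 : ℂ) else 0) :
    ((∑ k, A k ⊗ₖ (A k).map (starRingEnd ℂ)) -
      (1 / ∏ t ∈ Finset.range T, ((d : ℂ) + (t : ℂ))) •
        ∑ π : Equiv.Perm (Fin T), P π ⊗ₖ (P π).map (starRingEnd ℂ)).PosSemidef := by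
  have hP' : ∀ π, P π = tensorPerm (Fin T) (Fin d) π := fun π => by rw [hP]; rfl
  have hd' : (0 : ℝ) < d := by exact_mod_cast hd
  have hD : 0 < ∏ t ∈ Finset.range T, ((d : ℝ) + (t : ℝ)) :=
    Finset.prod_pos fun t _ => by positivity
  rw [funext hP'] at hspan
  have h := posSemidef_sum_kronecker_sub_smul_sum_kronecker (tensorPerm (Fin T) (Fin d))
    conjTranspose_tensorPerm hD (by rw [sum_norm_trace_tensorPerm, Fintype.card_fin]) hspan horth
  simp_rw [hP']
  simpa using h
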